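/- Let q ≥ 0 be an integer and let γ ∈ (0,1). Then the Chebyshev polynomial of the first kind satisfies T_q((1+γ)/(1−γ)) ≥ (1/2)·((1+√γ)/(1−√γ))^q ≥ (1/2)·exp(2·q·√γ). -/

import Mathlib

open Polynomial

theorem Real.two_mul_le_log_one_add_div_one_sub {x : ℝ} (hx0 : 0 ≤ x) (hx1 : x < 1) :
    2 * x ≤ Real.log ((1 + x) / (1 - x)) := by
  rw [Real.log_div (by linarith) (by linarith)]
  have h := Real.hasSum_log_sub_log_of_abs_lt_one (abs_lt.2 ⟨by linarith, hx1⟩)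
  simpa using le_hasSum h 0 fun k _ => by positivity

theorem Polynomial.Chebyshev.half_mul_pow_le_eval_T {r : ℝ} (hr : 0 < r) (n : ℕ) :
    (1 / 2 : ℝ) * r ^ n ≤ (Polynomial.Chebyshev.T ℝ n).eval ((r + r⁻¹) / 2) := by
  rw [← Real.cosh_log hr, Polynomial.Chebyshev.T_real_cosh, Real.cosh_eq]
  have h : Real.exp (((n : ℤ) : ℝ) * Real.log r) = r ^ n := by
    rw [Int.cast_natCast, Real.exp_nat_mul, Real.exp_log hr]
  rw [h]
  linarith [Real.exp_pos (-(((n : ℤ) : ℝ) * Real.log r))]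

/-- For every integer `q ≥ 0` and `γ ∈ (0,1)`, the Chebyshev polynomial of the
first kind satisfies
`T_q((1+γ)/(1-γ)) ≥ (1/2) ((1+√γ)/(1-√γ))^q ≥ (1/2) exp(2 q √γ)`. -/
theorem chebyshev_lower_bound (q : ℕ) (γ : ℝ) (hγ0 : 0 < γ) (hγ1 : γ < 1) :
    (1 / 2 : ℝ) * ((1 + Real.sqrt γ) / (1 - Real.sqrt γ)) ^ q ≤
      (Polynomial.Chebyshev.T ℝ q).eval ((1 + γ) / (1 - γ)) ∧
    (1 / 2 : ℝ) * Real.exp (2 * q * Real.sqrt γ) ≤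
      (1 / 2 : ℝ) * ((1 + Real.sqrt γ) / (1 - Real.sqrt γ)) ^ q := by
  have hs0 : 0 < Real.sqrt γ := Real.sqrt_pos.2 hγ0
  have hs1 : Real.sqrt γ < 1 := (Real.sqrt_lt' one_pos).2 (by simpa using hγ1)
  have hsq : Real.sqrt γ ^ 2 = γ := Real.sq_sqrt hγ0.le
  set s := Real.sqrt γ
  have hr : 0 < (1 + s) / (1 - s) := div_pos (by linarith) (by linarith)
  constructor
  · have hx : (1 + γ) / (1 - γ) = ((1 + s) / (1 - s) + ((1 + s) / (1 - s))⁻¹) / 2 := by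
      have h1 : 1 - s ≠ 0 := by intro h; linarith
      have h2 : 1 + s ≠ 0 := by intro h; linarith
      have h3 : 1 - s ^ 2 ≠ 0 := by intro h; linarith
      rw [← hsq]
      field_simp
      ring
    rw [hx]
    exact Polynomial.Chebyshev.half_mul_pow_le_eval_T hr q
  · have h : Real.exp (2 * s) ≤ (1 + s) / (1 - s) :=
      (Real.le_log_iff_exp_le hr).1 (Real.two_mul_le_log_one_add_div_one_sub hs0.le hs1)
    rw [show 2 * (q : ℝ) * s = q * (2 * s) by ring, Real.exp_nat_mul]
    gcongr
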